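/- arXiv:2001.01419 — 2 statements merged into one kernel-verified Lean document; each statement's English description precedes it below -/
import Mathlib

section
/- For every integer n ≥ 4, the complete graph K_n satisfies rmc_2(K_n) ≥ ⌊(3n² − 13n)/6⌋ + 2. -/
open SimpleGraph

/-- A walk is monochromatic with color `col` under the edge-coloring `c`. -/
def SimpleGraph.Walk.IsMonochromatic {V : Type*} {G : SimpleGraph V} (c : Sym2 V → ℕ)
    {u v : V} (W : G.Walk u v) (col : ℕ) : Prop :=
  ∀ e ∈ W.edges, c e = col

/-- `c` is a rainbow monochromatic `k`-edge-connection coloring of `G`: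
every two distinct vertices are joined by `k` pairwise edge-disjoint monochromatic
paths with pairwise distinct colors. -/
def SimpleGraph.IsRMCColoring {V : Type*} (G : SimpleGraph V) (k : ℕ) (c : Sym2 V → ℕ) : Prop :=
  ∀ u v : V, u ≠ v → ∃ (P : Fin k → G.Walk u v) (col : Fin k → ℕ),
    (∀ i, (P i).IsPath) ∧
    (∀ i, (P i).IsMonochromatic c (col i)) ∧
    (∀ i j, i ≠ j → ∀ e, e ∈ (P i).edges → e ∉ (P j).edges) ∧
    Function.Injective col

/-- The number of colors used by `c` on the edges of `G`. -/
noncomputable def SimpleGraph.colorsUsed {V : Type*} (G : SimpleGraph V) (c : Sym2 V → ℕ) : ℕ :=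
  (c '' G.edgeSet).ncard

/-- `rmc_k(G)`: the maximum number of colors in an RMC_k-coloring of `G` (0 if none exists). -/
noncomputable def SimpleGraph.rmc {V : Type*} (G : SimpleGraph V) (k : ℕ) : ℕ :=
  sSup {t | ∃ c : Sym2 V → ℕ, G.IsRMCColoring k c ∧ G.colorsUsed c = t}

/-- `τ(G) ≥ k`: `G` has `k` pairwise edge-disjoint spanning trees
(Nash-Williams–Tutte). -/
def SimpleGraph.TauGE {V : Type*} (G : SimpleGraph V) (k : ℕ) : Prop :=
  ∃ T : Fin k → SimpleGraph V, (∀ i, T i ≤ G) ∧ (∀ i, (T i).IsTree) ∧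
    ∀ i j, i ≠ j → Disjoint (T i).edgeSet (T j).edgeSet


/-- A path in the graph of all edges of color `k` is a monochromatic path of `G`. -/
theorem SimpleGraph.exists_isPath_isMonochromatic {V : Type*} {G H : SimpleGraph V}
    (c : Sym2 V → ℕ) (k : ℕ) (hHG : H ≤ G) (hH : ∀ e ∈ H.edgeSet, c e = k) {u v : V}
    (h : H.Reachable u v) : ∃ W : G.Walk u v, W.IsPath ∧ W.IsMonochromatic c k := by
  obtain ⟨W, hW⟩ := h.exists_isPath
  refine ⟨W.mapLe hHG, hW.mapLe hHG, fun e he => hH e ?_⟩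
  rw [Walk.edges_mapLe_eq_edges] at he
  exact W.edges_subset_edgeSet he

/-- Two monochromatic paths of distinct colors between any two vertices suffice for `k = 2`:
edge-disjointness is automatic. -/
theorem SimpleGraph.isRMCColoring_two {V : Type*} {G : SimpleGraph V} {c : Sym2 V → ℕ}
    (h : ∀ u v : V, u ≠ v → ∃ (P Q : G.Walk u v) (k l : ℕ), P.IsPath ∧ Q.IsPath ∧
      P.IsMonochromatic c k ∧ Q.IsMonochromatic c l ∧ k ≠ l) : G.IsRMCColoring 2 c := by
  intro u v huv
  obtain ⟨P, Q, k, l, hP, hQ, hPk, hQl, hkl⟩ := h u v huv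
  refine ⟨![P, Q], ![k, l], ?_, ?_, ?_, ?_⟩
  · simp [Fin.forall_fin_two, hP, hQ]
  · simp [Fin.forall_fin_two, hPk, hQl]
  · have h1 : ∀ e ∈ P.edges, e ∉ Q.edges := fun e he he' => hkl ((hPk e he).symm.trans (hQl e he'))
    have h2 : ∀ e ∈ Q.edges, e ∉ P.edges := fun e he he' => h1 e he' he
    simpa [Fin.forall_fin_two] using ⟨h1, h2⟩
  · intro i j
    fin_cases i <;> fin_cases j <;> simp [hkl, hkl.symm]

/-- Any RMC-coloring of a finite graph bounds `rmc` from below. -/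
theorem SimpleGraph.IsRMCColoring.colorsUsed_le_rmc {V : Type*} [Finite V] {G : SimpleGraph V}
    {k : ℕ} {c : Sym2 V → ℕ} (h : G.IsRMCColoring k c) : G.colorsUsed c ≤ G.rmc k := by
  refine le_csSup ⟨G.edgeSet.ncard, ?_⟩ ⟨c, h, rfl⟩
  rintro _ ⟨c', -, rfl⟩
  exact Set.ncard_image_le (Set.toFinite _)

namespace RMCTwo

/-- The edges `lo < hi` of a spanning tree on `{0, …, n - 1}`: paths
`0, 3i + 1, 3i + 2, 3i + 3` for `i < m`, and pendant edges from `0` to the vertices above `3m`. -/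
def TreeAdj (m lo hi : ℕ) : Prop :=
  (hi % 3 = 1 ∨ 3 * m < hi) ∧ lo = 0 ∨ hi % 3 ≠ 1 ∧ hi ≤ 3 * m ∧ lo + 1 = hi

/-- The edges `lo < hi` of a second spanning tree: paths `3i + 1, 3i + 3, 0, 3i + 2` for `i < m`,
and pendant edges from `2` to the vertices above `3m`. -/
def BranchAdj (m lo hi : ℕ) : Prop :=
  hi ≤ 3 * m ∧ (hi % 3 = 2 ∧ lo = 0 ∨ hi % 3 = 0 ∧ (lo = 0 ∨ lo + 2 = hi)) ∨ 3 * m < hi ∧ lo = 2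

open Classical in
/-- The first tree gets color `0`, each branch of the second tree its own color in `1, …, m`,
and every other edge its own color above `m`. -/
noncomputable def color (m lo hi : ℕ) : ℕ :=
  if TreeAdj m lo hi then 0
  else if BranchAdj m lo hi then 1 + (if 3 * m < hi then 0 else (hi - 1) / 3)
  else m + 1 + Nat.pair lo hi

/-- The edge-coloring of the complete graph induced by `color`. -/
noncomputable def coloring (n m : ℕ) : Sym2 (Fin n) → ℕ :=
  Sym2.lift ⟨fun u v => color m (min u.val v.val) (max u.val v.val), fun u v => by
    simp only [min_comm, max_comm]⟩

theorem coloring_of_lt {n m : ℕ} {u v : Fin n} (h : u.val < v.val) :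
    coloring n m s(u, v) = color m u v := by
  simp [coloring, min_eq_left h.le, max_eq_right h.le]

theorem color_eq_zero_iff {m lo hi : ℕ} : color m lo hi = 0 ↔ TreeAdj m lo hi := by
  unfold color
  split_ifs <;> simp_all

theorem color_of_branchAdj {m lo hi : ℕ} (h : BranchAdj m lo hi) :
    color m lo hi = 1 + (if 3 * m < hi then 0 else (hi - 1) / 3) := by
  have hT : ¬ TreeAdj m lo hi := by
    unfold TreeAdj
    unfold BranchAdj at h
    omega
  rw [color, if_neg hT, if_pos h]

theorem color_of_lt_color {m lo hi : ℕ} (hm : 1 ≤ m) (hlt : lo < hi) (h : m < color m lo hi) :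
    color m lo hi = m + 1 + Nat.pair lo hi := by
  unfold color at h ⊢
  split_ifs at h ⊢ <;> omega

theorem treeAdj_or_branchAdj_of_color_le {m lo hi : ℕ} (h : color m lo hi ≤ m) :
    TreeAdj m lo hi ∨ BranchAdj m lo hi := by
  by_contra! hc
  rw [color, if_neg hc.1, if_neg hc.2] at h
  omega

/-- The graph of all edges of color `k`. -/
def colorGraph (n m k : ℕ) : SimpleGraph (Fin n) where
  Adj u v := u ≠ v ∧ coloring n m s(u, v) = k
  symm := ⟨fun u v h => ⟨h.1.symm, by rw [Sym2.eq_swap]; exact h.2⟩⟩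
  loopless := ⟨fun _ h => h.1 rfl⟩

theorem reachable_of_color {n m k lo hi : ℕ} (hhi : hi < n) (hlt : lo < hi)
    (h : color m lo hi = k) :
    (colorGraph n m k).Reachable ⟨lo, hlt.trans hhi⟩ ⟨hi, hhi⟩ := by
  refine Adj.reachable ⟨by simpa using hlt.ne, ?_⟩
  rw [coloring_of_lt (by simpa using hlt)]
  exact h

theorem exists_path_of_reachable {n m k : ℕ} {u v : Fin n}
    (h : (colorGraph n m k).Reachable u v) :
    ∃ W : (⊤ : SimpleGraph (Fin n)).Walk u v,
      W.IsPath ∧ W.IsMonochromatic (coloring n m) k := by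
  refine exists_isPath_isMonochromatic _ k le_top ?_ h
  intro e
  induction e with | _ a b => exact fun h => h.2

theorem reachable_zero {n m : ℕ} (v : ℕ) (hv : v < n) :
    (colorGraph n m 0).Reachable ⟨0, by omega⟩ ⟨v, hv⟩ := by
  induction v with
  | zero => exact Reachable.rfl
  | succ v ih =>
    by_cases h : (v + 1) % 3 = 1 ∨ 3 * m < v + 1
    · exact reachable_of_color hv (by omega) (color_eq_zero_iff.2 (Or.inl ⟨h, rfl⟩))
    · refine (ih (by omega)).trans (reachable_of_color hv (by omega) (color_eq_zero_iff.2 ?_))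
      unfold TreeAdj
      omega

theorem exists_reachable_of_treeAdj {n m lo hi : ℕ} (hm : 1 ≤ m) (hn : 3 * m < n) (hhi : hi < n)
    (hlt : lo < hi) (h : TreeAdj m lo hi) :
    ∃ k, k ≠ 0 ∧ (colorGraph n m k).Reachable ⟨lo, hlt.trans hhi⟩ ⟨hi, hhi⟩ := by
  have branch : ∀ {a b i : ℕ} (hb : b < n) (hab : a < b), BranchAdj m a b →
      (if 3 * m < b then 0 else (b - 1) / 3) = i →
      (colorGraph n m (1 + i)).Reachable ⟨a, hab.trans hb⟩ ⟨b, hb⟩ := fun hb hab hB hi =>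
    reachable_of_color hb hab (by rw [color_of_branchAdj hB, hi])
  by_cases hbig : 3 * m < hi
  · obtain rfl : lo = 0 := by unfold TreeAdj at h; omega
    refine ⟨1 + 0, by omega, ?_⟩
    have h1 := branch (a := 0) (b := 2) (i := 0) (by omega) (by omega)
      (by unfold BranchAdj; omega) (by split_ifs <;> omega)
    have h2 := branch (a := 2) (b := hi) (i := 0) hhi (by omega)
      (by unfold BranchAdj; omega) (by split_ifs; omega)
    exact h1.trans h2
  · obtain ⟨i, r, hr, rfl⟩ : ∃ i r, r < 3 ∧ hi = 3 * i + 1 + r :=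
      ⟨(hi - 1) / 3, (hi - 1) % 3, by omega, by omega⟩
    have him : i < m := by omega
    have h02 := branch (a := 0) (b := 3 * i + 2) (i := i) (by omega) (by omega)
      (by unfold BranchAdj; omega) (by split_ifs <;> omega)
    have h03 := branch (a := 0) (b := 3 * i + 3) (i := i) (by omega) (by omega)
      (by unfold BranchAdj; omega) (by split_ifs <;> omega)
    have h13 := branch (a := 3 * i + 1) (b := 3 * i + 3) (i := i) (by omega) (by omega)
      (by unfold BranchAdj; omega) (by split_ifs <;> omega)
    refine ⟨1 + i, by omega, ?_⟩
    unfold TreeAdj at h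
    interval_cases r
    · obtain rfl : lo = 0 := by omega
      exact h03.trans h13.symm
    · obtain rfl : lo = 3 * i + 1 := by omega
      exact h13.trans (h03.symm.trans h02)
    · obtain rfl : lo = 3 * i + 2 := by omega
      exact h02.symm.trans h03

theorem isRMCColoring_coloring {n m : ℕ} (hm : 1 ≤ m) (hn : 3 * m < n) :
    (⊤ : SimpleGraph (Fin n)).IsRMCColoring 2 (coloring n m) := by
  have key : ∀ u v : Fin n, u.val < v.val → ∃ k, k ≠ 0 ∧ (colorGraph n m k).Reachable u v := by
    intro u v huv
    by_cases hT : TreeAdj m u v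
    · exact exists_reachable_of_treeAdj hm hn v.2 huv hT
    · exact ⟨_, mt color_eq_zero_iff.1 hT, reachable_of_color v.2 huv rfl⟩
  refine isRMCColoring_two fun u v huv => ?_
  obtain ⟨k, hk, hR⟩ : ∃ k, k ≠ 0 ∧ (colorGraph n m k).Reachable u v := by
    rcases lt_or_gt_of_ne (Fin.val_ne_of_ne huv) with h | h
    · exact key u v h
    · obtain ⟨k, hk, hR⟩ := key v u h
      exact ⟨k, hk, hR.symm⟩
  obtain ⟨P, hP, hPm⟩ :=
    exists_path_of_reachable ((reachable_zero (m := m) u u.2).symm.trans (reachable_zero v v.2))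
  obtain ⟨Q, hQ, hQm⟩ := exists_path_of_reachable hR
  exact ⟨P, Q, 0, k, hP, hQ, hPm, hQm, hk.symm⟩

theorem exists_lt_of_mem_edgeFinset_top {n : ℕ} {e : Sym2 (Fin n)}
    (he : e ∈ (⊤ : SimpleGraph (Fin n)).edgeFinset) : ∃ u v : Fin n, u.val < v.val ∧ e = s(u, v) := by
  induction e with | _ a b =>
  have hab : a ≠ b := by simpa using he
  rcases lt_or_gt_of_ne (Fin.val_ne_of_ne hab) with h | h
  · exact ⟨a, b, h, rfl⟩
  · exact ⟨b, a, h, Sym2.eq_swap⟩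

theorem card_filter_coloring_le {n m : ℕ} (hm : 1 ≤ m) (hn : 3 * m < n) :
    ((⊤ : SimpleGraph (Fin n)).edgeFinset.filter (coloring n m · ≤ m)).card ≤ 2 * (n - 1) := by
  let p : Fin n → Fin n := fun v =>
    ⟨if v.val % 3 = 1 ∨ 3 * m < v.val then 0 else v.val - 1, by split_ifs <;> omega⟩
  let q : Fin n → Fin n := fun v =>
    ⟨if 3 * m < v.val then 2 else if v.val % 3 = 1 then v.val + 2 else 0,
      by split_ifs <;> omega⟩
  let D : Finset (Fin n) := Finset.univ.erase ⟨0, by omega⟩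
  have hD : D.card = n - 1 := by simp [D]
  have hsub : (⊤ : SimpleGraph (Fin n)).edgeFinset.filter (coloring n m · ≤ m) ⊆
      D.image (fun v => s(p v, v)) ∪ D.image (fun v => s(q v, v)) := by
    intro e he
    obtain ⟨he, hc⟩ := Finset.mem_filter.1 he
    obtain ⟨u, v, huv, rfl⟩ := exists_lt_of_mem_edgeFinset_top he
    rw [coloring_of_lt huv] at hc
    have hvD : v ∈ D := by simp [D, Fin.ext_iff]; omega
    rw [Finset.mem_union, Finset.mem_image, Finset.mem_image]
    rcases treeAdj_or_branchAdj_of_color_le hc with h | h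
    · refine Or.inl ⟨v, hvD, ?_⟩
      have : p v = u := by
        unfold TreeAdj at h
        simp only [p, Fin.ext_iff]
        split_ifs <;> omega
      rw [this]
    · right
      by_cases h2 : u.val + 2 = v.val ∧ v.val ≤ 3 * m ∧ v.val % 3 = 0
      · refine ⟨u, by simp [D, Fin.ext_iff]; omega, ?_⟩
        have : q u = v := by
          simp only [q, Fin.ext_iff]
          split_ifs <;> omega
        rw [this, Sym2.eq_swap]
      · refine ⟨v, hvD, ?_⟩
        have : q v = u := by
          unfold BranchAdj at h
          simp only [q, Fin.ext_iff]
          split_ifs <;> omega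
        rw [this]
  have h1 := Finset.card_le_card hsub
  have h2 := Finset.card_union_le (D.image (fun v => s(p v, v))) (D.image (fun v => s(q v, v)))
  have h3 : (D.image (fun v => s(p v, v))).card ≤ D.card := Finset.card_image_le
  have h4 : (D.image (fun v => s(q v, v))).card ≤ D.card := Finset.card_image_le
  omega

theorem injOn_coloring {n m : ℕ} (hm : 1 ≤ m) :
    Set.InjOn (coloring n m)
      ((⊤ : SimpleGraph (Fin n)).edgeFinset.filter (¬ coloring n m · ≤ m) : Finset _) := by
  intro e he e' he' hee
  obtain ⟨he, hc⟩ := Finset.mem_filter.1 (Finset.mem_coe.1 he)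
  obtain ⟨he', hc'⟩ := Finset.mem_filter.1 (Finset.mem_coe.1 he')
  obtain ⟨u, v, huv, rfl⟩ := exists_lt_of_mem_edgeFinset_top he
  obtain ⟨u', v', huv', rfl⟩ := exists_lt_of_mem_edgeFinset_top he'
  rw [coloring_of_lt huv] at hee hc
  rw [coloring_of_lt huv'] at hee hc'
  rw [color_of_lt_color hm huv (not_le.1 hc), color_of_lt_color hm huv' (not_le.1 hc'),
    Nat.add_left_cancel_iff, Nat.pair_eq_pair] at hee
  rw [Fin.ext hee.1, Fin.ext hee.2]

theorem le_colorsUsed_coloring {n m : ℕ} (hm : 1 ≤ m) (hn : 3 * m < n) :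
    n.choose 2 + m + 1 ≤ (⊤ : SimpleGraph (Fin n)).colorsUsed (coloring n m) + 2 * (n - 1) := by
  have hbad := card_filter_coloring_le hm hn
  have hgood := Finset.card_image_of_injOn (injOn_coloring (n := n) hm)
  set E := (⊤ : SimpleGraph (Fin n)).edgeFinset with hE
  have hcard : E.card = n.choose 2 := by
    rw [hE, card_edgeFinset_top_eq_card_choose_two, Fintype.card_fin]
  have hsplit := Finset.card_filter_add_card_filter_not (s := E) (coloring n m · ≤ m)
  have hused : (⊤ : SimpleGraph (Fin n)).colorsUsed (coloring n m) =
      (E.image (coloring n m)).card := by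
    rw [colorsUsed, ← Set.ncard_coe_finset, Finset.coe_image, hE, coe_edgeFinset]
  have hdisj : Disjoint (Finset.range (m + 1))
      ((E.filter (¬ coloring n m · ≤ m)).image (coloring n m)) := by
    rw [Finset.disjoint_left]
    intro k hk hk'
    obtain ⟨e, he, rfl⟩ := Finset.mem_image.1 hk'
    have := (Finset.mem_filter.1 he).2
    rw [Finset.mem_range] at hk
    omega
  have hmem : ∀ {hi : ℕ}, 0 < hi → hi < n → color m 0 hi ∈ E.image (coloring n m) := by
    intro hi h0 hhi
    refine Finset.mem_image.2 ⟨s(⟨0, by omega⟩, ⟨hi, hhi⟩), ?_, coloring_of_lt h0⟩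
    simpa [hE] using h0.ne
  have hsub : Finset.range (m + 1) ∪ (E.filter (¬ coloring n m · ≤ m)).image (coloring n m) ⊆
      E.image (coloring n m) := by
    refine Finset.union_subset ?_ (Finset.image_subset_image (Finset.filter_subset _ _))
    intro k hk
    rw [Finset.mem_range] at hk
    rcases k with _ | i
    · have h := hmem (hi := 1) (by omega) (by omega)
      rwa [color_eq_zero_iff.2 (by unfold TreeAdj; omega)] at h
    · have h := hmem (hi := 3 * i + 3) (by omega) (by omega)
      rw [color_of_branchAdj (by unfold BranchAdj; omega), if_neg (by omega)] at h
      convert h using 1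
      omega
  have hle := Finset.card_le_card hsub
  rw [Finset.card_union_of_disjoint hdisj, Finset.card_range] at hle
  omega

end RMCTwo

/-- For `n ≥ 4`, `rmc_2(K_n) ≥ ⌊(3n² - 13n)/6⌋ + 2`. -/
theorem rmc_two_completeGraph (n : ℕ) (hn : 4 ≤ n) :
    (3 * (n : ℤ) ^ 2 - 13 * n).fdiv 6 + 2 ≤ ((⊤ : SimpleGraph (Fin n)).rmc 2 : ℤ) := by
  have hm : 1 ≤ (n - 1) / 3 := by omega
  have hmn : 3 * ((n - 1) / 3) < n := by omega
  have hle := (RMCTwo.isRMCColoring_coloring hm hmn).colorsUsed_le_rmc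
  have hcount := RMCTwo.le_colorsUsed_coloring hm hmn
  have hchoose : 2 * (n.choose 2 : ℤ) = (n : ℤ) ^ 2 - n := by
    have h := Nat.div_mul_cancel (Nat.even_mul_pred_self n).two_dvd
    rw [← Nat.choose_two_right] at h
    have h' : ((n.choose 2 * 2 : ℕ) : ℤ) = ((n * (n - 1) : ℕ) : ℤ) := by rw [h]
    push_cast [Nat.cast_sub (show 1 ≤ n by omega)] at h'
    linarith
  rw [Int.fdiv_eq_ediv_of_nonneg _ (by norm_num)]
  omega
end

section
/- Let k ≥ 2 and s ≥ 2 be integers, and let G be a (k,s)-perfectly-connected simple graph on n vertices with m edges, i.e., V(G) can be partitioned into s+1 parts {v}, V_1, …, V_s such that τ(G[V_i]) ≥ k for each i, the parts V_1, …, V_s induce between them a complete s-partite graph (every vertex of V_i is adjacent to every vertex of V_j for i ≠ j), and v has exactly k neighbors in each V_i. Then rmc_k(G) ≥ m − k(n − 2) + s − 1. -/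
open SimpleGraph

namespace SimpleGraph

variable {V : Type*} {κ : Type*}

/-- The spanning subgraph of `G` formed by the edges of color `a`. -/
def colorGraph (G : SimpleGraph V) (c : Sym2 V → κ) (a : κ) : SimpleGraph V where
  Adj u w := G.Adj u w ∧ c s(u, w) = a
  symm := ⟨fun u w h => ⟨h.1.symm, by rw [Sym2.eq_swap]; exact h.2⟩⟩
  loopless := ⟨fun u h => G.loopless.irrefl u h.1⟩

theorem colorGraph_le (G : SimpleGraph V) (c : Sym2 V → κ) (a : κ) : G.colorGraph c a ≤ G :=
  fun _ _ h => h.1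

theorem color_eq_of_mem_edgeSet_colorGraph {G : SimpleGraph V} {c : Sym2 V → κ} {a : κ}
    {e : Sym2 V} (he : e ∈ (G.colorGraph c a).edgeSet) : c e = a := by
  induction e with
  | h u w => exact he.2

theorem exists_isPath_of_reachable_colorGraph {G : SimpleGraph V} {c : Sym2 V → κ} {a : κ}
    {u w : V} (h : (G.colorGraph c a).Reachable u w) :
    ∃ p : G.Walk u w, p.IsPath ∧ ∀ e ∈ p.edges, c e = a := by
  classical
  obtain ⟨p, hp⟩ := h.exists_isPath
  refine ⟨p.mapLe (G.colorGraph_le c a), hp.mapLe _, fun e he => ?_⟩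
  rw [Walk.edges_mapLe_eq_edges] at he
  exact color_eq_of_mem_edgeSet_colorGraph (p.edges_subset_edgeSet he)

theorem ncard_image_edgeSet_le_rmc [Finite V] [Countable κ] {G : SimpleGraph V} {k : ℕ}
    (c : Sym2 V → κ)
    (h : ∀ u w, u ≠ w → ∃ col : Fin k → κ, Function.Injective col ∧
      ∀ j, (G.colorGraph c (col j)).Reachable u w) :
    (c '' G.edgeSet).ncard ≤ G.rmc k := by
  obtain ⟨f, hf⟩ := exists_injective_nat κ
  refine le_csSup ⟨G.edgeSet.ncard, ?_⟩ ⟨f ∘ c, fun u w huw => ?_, ?_⟩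
  · rintro t ⟨d, -, rfl⟩
    exact Set.ncard_image_le (Set.toFinite _)
  · obtain ⟨col, hcol, hr⟩ := h u w huw
    choose p hp hc using fun j => exists_isPath_of_reachable_colorGraph (hr j)
    refine ⟨p, f ∘ col, hp, fun j e he => congrArg f (hc j e he), fun i j hij e hi hj => ?_,
      hf.comp hcol⟩
    exact hij (hcol ((hc i e hi).symm.trans (hc j e hj)))
  · rw [colorsUsed, Set.image_comp, Set.ncard_image_of_injective _ hf]

/-- The edges of a graph `T` on `S`, together with an edge from `v` to `x`. -/
def pendantEdges {S : Set V} (T : SimpleGraph S) (v x : V) : Set (Sym2 V) :=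
  insert s(v, x) (Sym2.map Subtype.val '' T.edgeSet)

theorem ncard_pendantEdges_le [Finite V] {S : Set V} {T : SimpleGraph S} (hT : T.IsTree)
    (v x : V) : (pendantEdges T v x).ncard ≤ Nat.card S := by
  classical
  have := Fintype.ofFinite V
  have h := hT.card_edgeFinset
  rw [Nat.card_eq_fintype_card, ← h]
  refine (Set.ncard_insert_le _ _).trans (Nat.add_le_add_right ?_ 1)
  refine (Set.ncard_image_le (Set.toFinite _)).trans ?_
  rw [← coe_edgeFinset, Set.ncard_coe_finset]

theorem mem_of_mem_image_edgeSet {S : Set V} {T : SimpleGraph S} {e : Sym2 V}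
    (he : e ∈ Sym2.map Subtype.val '' T.edgeSet) {u : V} (hu : u ∈ e) : u ∈ S := by
  obtain ⟨a, -, rfl⟩ := he
  obtain ⟨b, -, rfl⟩ := Sym2.mem_map.1 hu
  exact b.2

theorem reachable_colorGraph_of_pendantEdges {G : SimpleGraph V} {c : Sym2 V → κ} {a : κ}
    {S : Set V} {T : SimpleGraph S} (hT : T.IsTree) (hTG : T ≤ G.induce S) {v x : V} (hx : x ∈ S)
    (hvx : G.Adj v x) (hc : ∀ e ∈ pendantEdges T v x, c e = a) {u : V} (hu : u ∈ S) :
    (G.colorGraph c a).Reachable u v := by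
  let φ : T →g G.colorGraph c a :=
    ⟨Subtype.val, fun {y z} h =>
      ⟨hTG h, hc _ (Or.inr ⟨s(y, z), h, rfl⟩)⟩⟩
  have h : (G.colorGraph c a).Reachable u x := (hT.connected.preconnected ⟨u, hu⟩ ⟨x, hx⟩).map φ
  have hxv : (G.colorGraph c a).Adj v x := ⟨hvx, hc _ (Or.inl rfl)⟩
  exact h.trans hxv.symm.reachable

theorem eq_of_mem_pendantEdges {ι J : Type*} {v : V} {P : ι → Set V}
    (hdisj : ∀ i j, i ≠ j → Disjoint (P i) (P j)) (hv : ∀ i, v ∉ P i)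
    {T : ∀ i, J → SimpleGraph (P i)}
    (hT : ∀ i j j', j ≠ j' → Disjoint (T i j).edgeSet (T i j').edgeSet)
    {x : ι → J → V} (hx : ∀ i j, x i j ∈ P i) (hxi : ∀ i, Function.Injective (x i))
    {p q : ι × J} {e : Sym2 V} (hp : e ∈ pendantEdges (T p.1 p.2) v (x p.1 p.2))
    (hq : e ∈ pendantEdges (T q.1 q.2) v (x q.1 q.2)) : p = q := by
  obtain ⟨i, j⟩ := p
  obtain ⟨i', j'⟩ := q
  have hpart : ∀ {u}, u ∈ P i → u ∈ P i' → i = i' := fun hu hu' => by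
    by_contra hne
    exact Set.disjoint_left.1 (hdisj i i' hne) hu hu'
  rcases hp with rfl | hp <;> rcases hq with hq | hq
  · have hxx : x i j = x i' j' := Sym2.congr_right.1 hq
    obtain rfl := hpart (hx i j) (hxx ▸ hx i' j')
    rw [hxi i hxx]
  · exact absurd (mem_of_mem_image_edgeSet hq (Sym2.mem_mk_left _ _)) (hv i')
  · subst hq
    exact absurd (mem_of_mem_image_edgeSet hp (Sym2.mem_mk_left _ _)) (hv i)
  · obtain rfl : i = i' :=
      hpart (mem_of_mem_image_edgeSet hp e.out_fst_mem)
        (mem_of_mem_image_edgeSet hq e.out_fst_mem)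
    obtain ⟨a, ha, rfl⟩ := hp
    obtain ⟨b, hb, hab⟩ := hq
    obtain rfl := Sym2.map.injective Subtype.val_injective hab
    by_contra hne
    exact Set.disjoint_left.1 (hT i j j' fun h => hne (h ▸ rfl)) ha hb

theorem notMem_pendantEdges {S : Set V} {T : SimpleGraph S} {v x u w : V} (hu : u ≠ v)
    (hw : w ≠ v) (h : u ∉ S ∨ w ∉ S) : s(u, w) ∉ pendantEdges T v x := by
  rintro (he | he)
  · have : v ∈ s(u, w) := he ▸ Sym2.mem_mk_left v x
    rcases Sym2.mem_iff.1 this with rfl | rfl <;> contradiction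
  · exact h.elim (fun h => h (mem_of_mem_image_edgeSet he (Sym2.mem_mk_left _ _)))
      fun h => h (mem_of_mem_image_edgeSet he (Sym2.mem_mk_right _ _))

/-- The color class of the tree with index `j` in the part with index `i`: the trees with a common
index `j` share a color, except for the last index, where each part has its own color. -/
def treeColor {s k : ℕ} (i : Fin s) (j : Fin (k + 1)) : Fin k ⊕ Fin s :=
  Fin.lastCases (motive := fun _ => Fin k ⊕ Fin s) (Sum.inr i) Sum.inl j

@[simp] theorem treeColor_last {s k : ℕ} (i : Fin s) :
    treeColor i (Fin.last k) = Sum.inr i := by simp [treeColor]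

@[simp] theorem treeColor_castSucc {s k : ℕ} (i : Fin s) (j : Fin k) :
    treeColor i j.castSucc = Sum.inl j := by simp [treeColor]

theorem treeColor_injective {s k : ℕ} (i : Fin s) :
    Function.Injective (treeColor i : Fin (k + 1) → _) := by
  intro a b
  induction a using Fin.lastCases <;> induction b using Fin.lastCases <;> simp

theorem exists_treeColor_eq {s k : ℕ} (hs : 0 < s) (a : Fin k ⊕ Fin s) :
    ∃ i j, treeColor i j = a := by
  rcases a with j | i
  · exact ⟨⟨0, hs⟩, j.castSucc, by simp⟩
  · exact ⟨i, Fin.last k, by simp⟩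

theorem sum_card_add_one_le [Fintype V] {ι : Type*} [Fintype ι] {v : V} {P : ι → Set V}
    (hdisj : ∀ i j, i ≠ j → Disjoint (P i) (P j)) (hv : ∀ i, v ∉ P i) :
    ∑ i, Nat.card (P i) + 1 ≤ Fintype.card V := by
  classical
  have hinj : Function.Injective
      (fun o : Option (Σ i, P i) => o.elim v fun a => (a.2 : V)) := by
    rintro (_ | ⟨i, a⟩) (_ | ⟨j, b⟩) h
    · rfl
    · exact absurd ((show v = b from h) ▸ b.2) (hv j)
    · exact absurd ((show (a : V) = v from h) ▸ a.2) (hv i)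
    · replace h : (a : V) = b := h
      obtain rfl : i = j := by
        by_contra hne
        exact Set.disjoint_left.1 (hdisj i j hne) a.2 (h ▸ b.2)
      rw [Subtype.ext h]
  simpa [Nat.card_eq_fintype_card] using Fintype.card_le_of_injective _ hinj

end SimpleGraph

/-- If `G` is `(k,s)`-perfectly-connected (with `k, s ≥ 2`), i.e. `V(G)` is
partitioned into `{v}, V_1, …, V_s` with `τ(G[V_i]) ≥ k`, all edges present
between different parts `V_i, V_j`, and `v` having exactly `k` neighbours in
each `V_i`, then `rmc_k(G) ≥ m - k(n-2) + s - 1`. -/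
theorem rmc_ge_of_perfectlyConnected {V : Type*} [Fintype V] (G : SimpleGraph V) (k s : ℕ)
    (hk : 2 ≤ k) (hs : 2 ≤ s) (v : V) (P : Fin s → Set V)
    (hdisj : ∀ i j, i ≠ j → Disjoint (P i) (P j))
    (hv : ∀ i, v ∉ P i)
    (hcover : ∀ u : V, u ≠ v → ∃ i, u ∈ P i)
    (htau : ∀ i, (G.induce (P i)).TauGE k)
    (hmulti : ∀ i j, i ≠ j → ∀ u ∈ P i, ∀ w ∈ P j, G.Adj u w)
    (hnbrs : ∀ i, {u ∈ P i | G.Adj v u}.ncard = k) :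
    G.edgeSet.ncard - k * (Fintype.card V - 2) + s - 1 ≤ G.rmc k := by
  classical
  obtain ⟨k, rfl⟩ : ∃ k', k = k' + 1 := ⟨k - 1, by omega⟩
  choose T hTG hT hTd using htau
  have hexists : ∀ i, ∃ x : Fin (k + 1) → V,
      Function.Injective x ∧ ∀ j, x j ∈ P i ∧ G.Adj v (x j) := fun i => by
    have hcard : Nat.card {u ∈ P i | G.Adj v u} = k + 1 := hnbrs i
    let e := (Finite.equivFinOfCardEq hcard).symm
    exact ⟨fun j => (e j : V), Subtype.val_injective.comp e.injective, fun j => (e j).2⟩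
  choose x hxi hx using hexists
  let H : Fin s × Fin (k + 1) → Set (Sym2 V) :=
    fun p => pendantEdges (T p.1 p.2) v (x p.1 p.2)
  let c : Sym2 V → (Fin k ⊕ Fin s) ⊕ Sym2 V := fun e =>
    if h : ∃ p, e ∈ H p then Sum.inl (treeColor h.choose.1 h.choose.2) else Sum.inr e
  have hcH : ∀ i j, ∀ e ∈ H (i, j), c e = Sum.inl (treeColor i j) := fun i j e he => by
    have h : ∃ p, e ∈ H p := ⟨_, he⟩
    have hp : h.choose = (i, j) :=
      eq_of_mem_pendantEdges hdisj hv hTd (fun i j => (hx i j).1) hxi h.choose_spec he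
    simp only [c, dif_pos h, hp]
  have hcn : ∀ e, (∀ p, e ∉ H p) → c e = Sum.inr e := fun e he =>
    dif_neg (not_exists.2 he)
  have hreach : ∀ i j, ∀ u ∈ P i,
      (G.colorGraph c (Sum.inl (treeColor i j))).Reachable u v := fun i j u hu =>
    reachable_colorGraph_of_pendantEdges (hT i j) (hTG i j) (hx i j).1 (hx i j).2 (hcH i j) hu
  have hinl : ∀ i : Fin s, Function.Injective
      fun j : Fin (k + 1) => (Sum.inl (treeColor i j) : (Fin k ⊕ Fin s) ⊕ Sym2 V) :=
    fun i => Sum.inl_injective.comp (treeColor_injective i)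
  have hmain : (c '' G.edgeSet).ncard ≤ G.rmc (k + 1) := by
    refine ncard_image_edgeSet_le_rmc c fun u w huw => ?_
    by_cases hu : u = v
    · subst hu
      obtain ⟨i, hi⟩ := hcover w huw.symm
      exact ⟨_, hinl i, fun j => (hreach i j w hi).symm⟩
    obtain ⟨i, hi⟩ := hcover u hu
    by_cases hw : w = v
    · subst hw
      exact ⟨_, hinl i, fun j => hreach i j u hi⟩
    obtain ⟨i', hi'⟩ := hcover w hw
    by_cases hii : i = i'
    · subst hii
      exact ⟨_, hinl i, fun j => (hreach i j u hi).trans (hreach i j w hi').symm⟩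
    refine ⟨Fin.lastCases (Sum.inr s(u, w)) fun j => Sum.inl (Sum.inl j), fun a b => ?_,
      fun j => ?_⟩
    · induction a using Fin.lastCases <;> induction b using Fin.lastCases <;> simp
    · induction j using Fin.lastCases with
      | last =>
        have hadj : (G.colorGraph c (Sum.inr s(u, w))).Adj u w := by
          refine ⟨hmulti i i' hii u hi w hi', hcn _ fun p => notMem_pendantEdges hu hw ?_⟩
          by_contra! hcon
          by_cases hp : p.1 = i
          · exact Set.disjoint_left.1 (hdisj i i' hii) (hp ▸ hcon.2) hi'
          · exact Set.disjoint_left.1 (hdisj p.1 i hp) hcon.1 hi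
        simpa using hadj.reachable
      | cast j =>
        have h₁ := hreach i j.castSucc u hi
        have h₂ := hreach i' j.castSucc w hi'
        rw [treeColor_castSucc] at h₁ h₂
        simpa using h₁.trans h₂.symm
  have hcount : (⋃ p, H p).ncard ≤ (k + 1) * (Fintype.card V - 1) := calc
    (⋃ p, H p).ncard ≤ ∑ p, (H p).ncard := by
      simpa using Set.ncard_iUnion_le_of_fintype H
    _ ≤ ∑ p : Fin s × Fin (k + 1), Nat.card (P p.1) :=
      Finset.sum_le_sum fun p _ => ncard_pendantEdges_le (hT p.1 p.2) _ _
    _ = (k + 1) * ∑ i, Nat.card (P i) := by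
      rw [Fintype.sum_prod_type, Finset.mul_sum]
      simp
    _ ≤ (k + 1) * (Fintype.card V - 1) :=
      Nat.mul_le_mul_left _ (Nat.le_sub_of_add_le (sum_card_add_one_le hdisj hv))
  have hcolors : k + s + (G.edgeSet \ ⋃ p, H p).ncard ≤ (c '' G.edgeSet).ncard := by
    have hsub : Sum.inl '' Set.univ ∪ Sum.inr '' (G.edgeSet \ ⋃ p, H p) ⊆ c '' G.edgeSet := by
      rintro _ (⟨a, -, rfl⟩ | ⟨e, he, rfl⟩)
      · obtain ⟨i, j, rfl⟩ := exists_treeColor_eq (by omega) a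
        exact ⟨s(v, x i j), (hx i j).2, hcH i j _ (Or.inl rfl)⟩
      · exact ⟨e, he.1, hcn e fun p hp => he.2 (Set.mem_iUnion.2 ⟨p, hp⟩)⟩
    refine le_trans (le_of_eq ?_) (Set.ncard_le_ncard hsub (Set.toFinite _))
    rw [Set.ncard_union_eq (Set.disjoint_image_inl_image_inr) (Set.toFinite _) (Set.toFinite _),
      Set.ncard_image_of_injective _ Sum.inl_injective,
      Set.ncard_image_of_injective _ Sum.inr_injective, Set.ncard_univ]
    simp
  have hdiff := Set.ncard_le_ncard_sdiff_add_ncard G.edgeSet (⋃ p, H p) (Set.toFinite _)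
  have hn : 1 < Fintype.card V :=
    Fintype.one_lt_card_iff.2 ⟨v, x ⟨0, by omega⟩ 0, (hx _ _).2.ne⟩
  have hmul : (k + 1) * (Fintype.card V - 1) = (k + 1) * (Fintype.card V - 2) + (k + 1) := by
    rw [← Nat.mul_succ]
    congr 1
    omega
  omega
end
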